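/- Let u be a solution of the IVP with initial value α ≠ 1, and suppose that at some r̄ ≥ 0 one has E(r̄) ≤ 0 and u(r̄) > 0, where E(r) = u'(r)²/2 + F(u(r)). Then 0 < u(r) < α_* for all r > r̄, where α_* = ((p+1)/2)^{1/(p−1)}, and u oscillates about the constant 1: the set { r > r̄ : u(r) = 1 } is infinite. The analogous conclusion holds for −u if instead E(r̄) ≤ 0 and u(r̄) < 0. -/

import Mathlib

open Real Filter Set

/-- The nonlinearity `f(s) = -s + |s|^(p-1) s`. -/
noncomputable def f (p s : ℝ) : ℝ := -s + |s| ^ (p - 1) * s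

/-- The derivative of the nonlinearity, `f'(s) = -1 + p |s|^(p-1)`. -/
noncomputable def fder (p s : ℝ) : ℝ := -1 + p * |s| ^ (p - 1)

/-- The primitive `F(s) = -s^2/2 + |s|^(p+1)/(p+1)`. -/
noncomputable def F (p s : ℝ) : ℝ := -s ^ 2 / 2 + |s| ^ (p + 1) / (p + 1)

/-- `u : [0,∞) → ℝ` (modeled on `Set.Ici 0`) is a C² solution of the IVP
`u'' + ((n-1)/r) u' + f(u) = 0`, `u(0) = α`, `u'(0) = 0`; the data `u'`, `u''`
are its first and second derivatives on `[0,∞)`. -/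
structure IsSolution (n : ℕ) (p α : ℝ) (u u' u'' : ℝ → ℝ) : Prop where
  init : u 0 = α
  initDeriv : u' 0 = 0
  hasDeriv1 : ∀ r ∈ Set.Ici (0:ℝ), HasDerivWithinAt u (u' r) (Set.Ici 0) r
  hasDeriv2 : ∀ r ∈ Set.Ici (0:ℝ), HasDerivWithinAt u' (u'' r) (Set.Ici 0) r
  cont2 : ContinuousOn u'' (Set.Ici 0)
  ode : ∀ r : ℝ, 0 < r → u'' r + ((n : ℝ) - 1) / r * u' r + f p (u r) = 0

/-- The variation `v` associated with a solution `u`: the C² solution of the linearized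
equation `v'' + ((n-1)/r) v' + f'(u) v = 0`, `v(0) = 1`, `v'(0) = 0`. -/
structure IsVariation (n : ℕ) (p : ℝ) (u v v' v'' : ℝ → ℝ) : Prop where
  init : v 0 = 1
  initDeriv : v' 0 = 0
  hasDeriv1 : ∀ r ∈ Set.Ici (0:ℝ), HasDerivWithinAt v (v' r) (Set.Ici 0) r
  hasDeriv2 : ∀ r ∈ Set.Ici (0:ℝ), HasDerivWithinAt v' (v'' r) (Set.Ici 0) r
  cont2 : ContinuousOn v'' (Set.Ici 0)
  ode : ∀ r : ℝ, 0 < r → v'' r + ((n : ℝ) - 1) / r * v' r + fder p (u r) * v r = 0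

/-- `u` is decaying: `u(r) → 0` and `u'(r) → 0` as `r → ∞`. -/
def Decaying (u u' : ℝ → ℝ) : Prop :=
  Filter.Tendsto u Filter.atTop (nhds 0) ∧ Filter.Tendsto u' Filter.atTop (nhds 0)

/-- `u` changes sign on `(0,∞)`. -/
def ChangesSign (u : ℝ → ℝ) : Prop :=
  (∃ r : ℝ, 0 < r ∧ u r < 0) ∧ (∃ r : ℝ, 0 < r ∧ 0 < u r)

/-- `z 0 < z 1 < ⋯ < z (k-1)` are exactly the zeros of `u` in `(0,∞)`. -/
def ExactZeros (u : ℝ → ℝ) (k : ℕ) (z : Fin k → ℝ) : Prop :=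
  StrictMono z ∧ (∀ i, 0 < z i ∧ u (z i) = 0) ∧
    ∀ r : ℝ, 0 < r → u r = 0 → ∃ i, r = z i

lemma abs_rpow_add_one (p s : ℝ) (hp : 1 < p) : |s| ^ (p + 1) = |s| ^ (p - 1) * s ^ 2 := by
  rcases eq_or_ne s 0 with rfl | hs
  · rw [abs_zero, zero_rpow (by linarith)]
    simp
  · rw [← sq_abs s, ← rpow_natCast |s| 2, ← rpow_add (abs_pos.mpr hs)]
    congr 1
    push_cast
    ring

lemma hasDerivAt_F {p : ℝ} (hp : 1 < p) (s : ℝ) : HasDerivAt (F p) (f p s) s := by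
  have h1 : HasDerivAt (fun x : ℝ => |x| ^ (p + 1)) ((p + 1) * |s| ^ (p + 1 - 2) * s) s :=
    hasDerivAt_abs_rpow s (by linarith)
  have h2 := (((hasDerivAt_id s).pow 2).neg.div_const 2).add (h1.div_const (p + 1))
  have hp0 : p + 1 ≠ 0 := by linarith
  refine h2.congr_deriv ?_
  rw [show p + 1 - 2 = p - 1 by ring, f]
  simp only [id]
  field_simp
  push_cast
  ring

lemma F_neg (p s : ℝ) : F p (-s) = F p s := by simp [F]

lemma f_neg (p s : ℝ) : f p (-s) = -f p s := by simp [f]; ring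

lemma F_neg_of_f_eq_zero {p s : ℝ} (hp : 1 < p) (hs : s ≠ 0) (h : f p s = 0) : F p s < 0 := by
  have h1 : |s| ^ (p - 1) * s ^ 2 = s ^ 2 := by
    rw [f] at h
    linear_combination s * h
  have hs2 : 0 < s ^ 2 := by positivity
  rw [F, abs_rpow_add_one p s hp, h1, neg_div, neg_add_lt_iff_lt_add, add_zero]
  exact div_lt_div_of_pos_left hs2 two_pos (by linarith)

lemma lt_of_F_neg {p s : ℝ} (hp : 1 < p) (hs : 0 < s) (h : F p s < 0) :
    s < ((p + 1) / 2) ^ (1 / (p - 1)) := by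
  rw [F, abs_rpow_add_one p s hp, abs_of_pos hs] at h
  have hs2 : 0 < s ^ 2 := by positivity
  have hpp : 0 < p + 1 := by linarith
  have h1 : s ^ (p - 1) < (p + 1) / 2 := by
    have h2 : s ^ (p - 1) * s ^ 2 / (p + 1) < s ^ 2 / 2 := by linarith
    rw [div_lt_div_iff₀ hpp two_pos] at h2
    nlinarith
  rw [one_div]
  exact (lt_rpow_inv_iff_of_pos hs.le (by linarith) (by linarith)).mpr h1

lemma F_zero (p : ℝ) (hp : 1 < p) : F p 0 = 0 := by
  rw [F, abs_zero, zero_rpow (by linarith)]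
  simp

/-- Tangent line bound for `f` above the equilibrium `1`. -/
lemma mul_sub_one_le_f {p s : ℝ} (hp : 1 < p) (hs : 0 < s) : (p - 1) * (s - 1) ≤ f p s := by
  have h := one_add_mul_self_le_rpow_one_add (s := s - 1) (by linarith) hp.le
  have h1 : s ^ (p - 1) * s = s ^ p := by
    rw [← rpow_add_one hs.ne', sub_add_cancel]
  rw [f, abs_of_pos hs, h1]
  rw [add_sub_cancel] at h
  linarith

/-- Linear bound for `-f` between a positive constant and the equilibrium `1`. -/
lemma mul_one_sub_le_neg_f {p d s : ℝ} (hp : 1 < p) (hd : 0 < d) (hds : d ≤ s) (hs : s ≤ 1) :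
    d * min (p - 1) 1 * (1 - s) ≤ -f p s := by
  have hs0 : 0 < s := hd.trans_le hds
  have hpow : s ^ (p - 1) ≤ s ^ (min (p - 1) 1) :=
    rpow_le_rpow_of_exponent_ge hs0 hs (min_le_left _ _)
  have hmin : 0 ≤ min (p - 1) 1 := le_min (by linarith) zero_le_one
  have h := rpow_one_add_le_one_add_mul_self (s := s - 1) (by linarith) hmin (min_le_right _ _)
  rw [add_sub_cancel] at h
  have h1 : min (p - 1) 1 * (1 - s) ≤ 1 - s ^ (p - 1) := by linarith
  have h2 : 0 ≤ min (p - 1) 1 * (1 - s) := mul_nonneg hmin (by linarith)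
  rw [f, abs_of_pos hs0]
  calc d * min (p - 1) 1 * (1 - s) = d * (min (p - 1) 1 * (1 - s)) := by ring
    _ ≤ s * (1 - s ^ (p - 1)) := by gcongr
    _ = -(-s + s ^ (p - 1) * s) := by ring

/-- A function with `w'' + (m/r) w' + c w ≤ 0`, `c > 0`, cannot stay positive near infinity:
the Riccati variable `w'/w` would blow down in finite time. -/
lemma not_eventually_pos_of_linear_ineq {w w' w'' : ℝ → ℝ} {m c R : ℝ} (hc : 0 < c)
    (hw : ∀ r, R < r → HasDerivAt w (w' r) r) (hw' : ∀ r, R < r → HasDerivAt w' (w'' r) r)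
    (hpos : ∀ r, R < r → 0 < w r)
    (hineq : ∀ r, R < r → w'' r + m / r * w' r + c * w r ≤ 0) : False := by
  obtain ⟨S, hSR, hS0, hSm⟩ : ∃ S, R < S ∧ 0 < S ∧ ∀ r, S ≤ r → (m / r) ^ 2 ≤ c := by
    have hlim : Tendsto (fun r : ℝ => (m / r) ^ 2) atTop (nhds 0) := by
      simpa using (tendsto_const_nhds.div_atTop tendsto_id : Tendsto (fun r : ℝ => m / r)
        atTop (nhds 0)).pow 2
    obtain ⟨T, hT⟩ := eventually_atTop.mp (hlim.eventually (ge_mem_nhds hc))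
    refine ⟨max (R + 1) (max 1 T), ?_, ?_, fun r hr => hT r ?_⟩
    · exact (lt_add_one R).trans_le (le_max_left _ _)
    · exact zero_lt_one.trans_le ((le_max_left _ _).trans (le_max_right _ _))
    · exact ((le_max_right _ _).trans (le_max_right _ _)).trans hr
  set k := min c 1 / 2 with hk
  have hk0 : 0 < k := by positivity
  have hkc : 2 * k ≤ c := by rw [hk]; linarith [min_le_left c 1]
  have hk1 : 2 * k ≤ 1 := by rw [hk]; linarith [min_le_right c 1]
  have hder : ∀ r, S ≤ r → HasDerivAt (fun t => arctan (w' t / w t) + k * t)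
      (1 / (1 + (w' r / w r) ^ 2) * ((w'' r * w r - w' r * w' r) / w r ^ 2) + k * 1) r := by
    intro r hr
    have hRr := hSR.trans_le hr
    exact ((hw' r hRr).div (hw r hRr) (hpos r hRr).ne').arctan.add
      ((hasDerivAt_id r).const_mul k)
  have hanti : AntitoneOn (fun t => arctan (w' t / w t) + k * t) (Ici S) := by
    refine antitoneOn_of_deriv_nonpos (convex_Ici S)
      (fun r hr => (hder r hr).continuousAt.continuousWithinAt)
      (fun r hr => (hder r (interior_subset hr)).differentiableAt.differentiableWithinAt) ?_
    intro r hr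
    have hSr : S ≤ r := interior_subset hr
    have hRr := hSR.trans_le hSr
    have hw0 := hpos r hRr
    rw [(hder r hSr).deriv]
    have hs : (w'' r * w r - w' r * w' r) / w r ^ 2 ≤
        -c - m / r * (w' r / w r) - (w' r / w r) ^ 2 := by
      have : -c - m / r * (w' r / w r) - (w' r / w r) ^ 2 =
          ((-c * w r - m / r * w' r) * w r - w' r * w' r) / w r ^ 2 := by
        field_simp
      rw [this]
      gcongr
      linarith [hineq r hRr]
    have hden : 0 < 1 + (w' r / w r) ^ 2 := by positivity
    generalize w' r / w r = σ at *
    have h2 : (w'' r * w r - w' r * w' r) / w r ^ 2 ≤ -k * (1 + σ ^ 2) := by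
      nlinarith [sq_nonneg (m / r + σ), hSm r hSr, mul_nonneg (sub_nonneg.mpr hk1) (sq_nonneg σ)]
    have h3 : 1 / (1 + σ ^ 2) * ((w'' r * w r - w' r * w' r) / w r ^ 2) ≤ -k := by
      rw [one_div, inv_mul_le_iff₀ hden]
      linarith
    linarith
  have hle : S ≤ S + π / k := le_add_of_nonneg_right (by positivity)
  have h := hanti self_mem_Ici hle hle
  simp only [mul_add, mul_div_cancel₀ π hk0.ne'] at h
  linarith [neg_pi_div_two_lt_arctan (w' (S + π / k) / w (S + π / k)),
    arctan_lt_pi_div_two (w' S / w S)]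

namespace IsSolution

variable {n : ℕ} {p α : ℝ} {u u' u'' : ℝ → ℝ}

lemma hasDerivAt_u (hu : IsSolution n p α u u' u'') {r : ℝ} (hr : 0 < r) :
    HasDerivAt u (u' r) r :=
  (hu.hasDeriv1 r hr.le).hasDerivAt (Ici_mem_nhds hr)

lemma hasDerivAt_u' (hu : IsSolution n p α u u' u'') {r : ℝ} (hr : 0 < r) :
    HasDerivAt u' (u'' r) r :=
  (hu.hasDeriv2 r hr.le).hasDerivAt (Ici_mem_nhds hr)

lemma continuousOn (hu : IsSolution n p α u u' u'') : ContinuousOn u (Ici 0) :=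
  fun r hr => (hu.hasDeriv1 r hr).continuousWithinAt

lemma neg (hu : IsSolution n p α u u' u'') : IsSolution n p (-α) (-u) (-u') (-u'') where
  init := by simp [hu.init]
  initDeriv := by simp [hu.initDeriv]
  hasDeriv1 r hr := (hu.hasDeriv1 r hr).neg
  hasDeriv2 r hr := (hu.hasDeriv2 r hr).neg
  cont2 := hu.cont2.neg
  ode r hr := by
    simp only [Pi.neg_apply, f_neg]
    linear_combination -hu.ode r hr

lemma hasDerivAt_energy (hu : IsSolution n p α u u' u'') (hp : 1 < p) {r : ℝ} (hr : 0 < r) :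
    HasDerivAt (fun t => u' t ^ 2 / 2 + F p (u t)) (-(((n : ℝ) - 1) / r * u' r ^ 2)) r := by
  have h := (((hu.hasDerivAt_u' hr).pow 2).div_const 2).add
    ((hasDerivAt_F hp (u r)).comp r (hu.hasDerivAt_u hr))
  refine h.congr_deriv ?_
  push_cast
  linear_combination u' r * hu.ode r hr

lemma antitoneOn_energy (hu : IsSolution n p α u u' u'') (hn : 1 ≤ n) (hp : 1 < p) :
    AntitoneOn (fun t => u' t ^ 2 / 2 + F p (u t)) (Ici 0) := by
  refine antitoneOn_of_deriv_nonpos (convex_Ici 0) ?_ ?_ ?_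
  · have hF : Continuous (F p) :=
      continuous_iff_continuousAt.mpr fun s => (hasDerivAt_F hp s).continuousAt
    have hu'c : ContinuousOn u' (Ici 0) := fun r hr => (hu.hasDeriv2 r hr).continuousWithinAt
    exact ((hu'c.pow 2).div_const 2).add (hF.comp_continuousOn hu.continuousOn)
  · rw [interior_Ici]
    exact fun r hr => (hu.hasDerivAt_energy hp hr).differentiableAt.differentiableWithinAt
  · rw [interior_Ici]
    intro r hr
    have hr0 : 0 < r := hr
    rw [(hu.hasDerivAt_energy hp hr).deriv, neg_nonpos]
    have : (0 : ℝ) ≤ (n : ℝ) - 1 := sub_nonneg.mpr (by exact_mod_cast hn)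
    positivity

lemma energy_neg (hu : IsSolution n p α u u' u'') (hn : 2 ≤ n) (hp : 1 < p) {b r : ℝ}
    (hb : 0 ≤ b) (hE : u' b ^ 2 / 2 + F p (u b) ≤ 0) (hub : 0 < u b) (hr : b < r) :
    u' r ^ 2 / 2 + F p (u r) < 0 := by
  have hanti := hu.antitoneOn_energy (by omega) hp
  by_contra! hEr
  have hconst : ∀ t ∈ Icc b r, u' t ^ 2 / 2 + F p (u t) = 0 := fun t ht =>
    le_antisymm ((hanti hb (hb.trans ht.1) ht.1).trans hE)
      (hEr.trans (hanti (hb.trans ht.1) (hb.trans hr.le) ht.2))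
  have hu'0 : ∀ t ∈ Ioo b r, u' t = 0 := by
    intro t ht
    have ht0 : 0 < t := hb.trans_lt ht.1
    have hloc : (fun t => u' t ^ 2 / 2 + F p (u t)) =ᶠ[nhds t] fun _ => 0 := by
      filter_upwards [Ioo_mem_nhds ht.1 ht.2] with x hx using hconst x (Ioo_subset_Icc_self hx)
    have h := (hu.hasDerivAt_energy hp ht0).unique
      ((hasDerivAt_const t (0 : ℝ)).congr_of_eventuallyEq hloc)
    have hn1 : (0 : ℝ) < (n : ℝ) - 1 := sub_pos.mpr (by exact_mod_cast hn)
    have hcoef : ((n : ℝ) - 1) / t ≠ 0 := by positivity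
    simpa [hcoef] using h
  set t := (b + r) / 2 with ht_def
  have ht : t ∈ Ioo b r := ⟨by rw [ht_def]; linarith, by rw [ht_def]; linarith⟩
  have ht0 : 0 < t := hb.trans_lt ht.1
  have hu''0 : u'' t = 0 := by
    have hloc : u' =ᶠ[nhds t] fun _ => 0 := by
      filter_upwards [Ioo_mem_nhds ht.1 ht.2] with x hx using hu'0 x hx
    exact (hu.hasDerivAt_u' ht0).unique
      ((hasDerivAt_const t (0 : ℝ)).congr_of_eventuallyEq hloc)
  have hf : f p (u t) = 0 := by
    have := hu.ode t ht0
    rwa [hu''0, hu'0 t ht, mul_zero, zero_add, zero_add] at this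
  have hut : u t = u b := by
    obtain ⟨c, hc, hslope⟩ := exists_hasDerivAt_eq_slope u u' ht.1
      (hu.continuousOn.mono fun x hx => hb.trans hx.1)
      fun x hx => hu.hasDerivAt_u (hb.trans_lt hx.1)
    rw [hu'0 c ⟨hc.1, hc.2.trans ht.2⟩, eq_comm, div_eq_zero_iff] at hslope
    rcases hslope with h | h
    · linarith
    · linarith [ht.1]
  have hFneg := F_neg_of_f_eq_zero hp (hut ▸ hub.ne') hf
  have := hconst t (Ioo_subset_Icc_self ht)
  rw [hu'0 t ht] at this
  linarith

lemma pos_of_energy_nonpos (hu : IsSolution n p α u u' u'') (hn : 2 ≤ n) (hp : 1 < p) {b r : ℝ}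
    (hb : 0 ≤ b) (hE : u' b ^ 2 / 2 + F p (u b) ≤ 0) (hub : 0 < u b) (hr : b < r) : 0 < u r := by
  by_contra! hur
  obtain ⟨t, ht, ht0⟩ := intermediate_value_Icc' hr.le
    (hu.continuousOn.mono fun x hx => hb.trans hx.1) (⟨hur, hub.le⟩ : (0 : ℝ) ∈ Icc (u r) (u b))
  have hbt : b < t := lt_of_le_of_ne ht.1 (by rintro rfl; exact hub.ne' ht0)
  have h := hu.energy_neg hn hp hb hE hub hbt
  rw [ht0, F_zero p hp] at h
  linarith [sq_nonneg (u' t)]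

lemma infinite_eq_one (hu : IsSolution n p α u u' u'') (hn : 2 ≤ n) (hp : 1 < p) {b : ℝ}
    (hb : 0 ≤ b) (hE : u' b ^ 2 / 2 + F p (u b) ≤ 0) (hub : 0 < u b) :
    {r : ℝ | b < r ∧ u r = 1}.Infinite := by
  intro hfin
  obtain ⟨M, hM⟩ := hfin.bddAbove
  set R := max M (b + 1) with hR
  have hbR : b < R := (lt_add_one b).trans_le (le_max_right _ _)
  have hR0 : 0 ≤ R := hb.trans hbR.le
  have hne : ∀ r, R < r → u r ≠ 1 := fun r hr h1 =>
    absurd (hM ⟨hbR.trans hr, h1⟩) (not_le.mpr ((le_max_left _ _).trans_lt hr))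
  have hupos : ∀ r, R < r → 0 < u r := fun r hr =>
    hu.pos_of_energy_nonpos hn hp hb hE hub (hbR.trans hr)
  have hcont : ContinuousOn u (Ioi R) := hu.continuousOn.mono fun x hx => hR0.trans (le_of_lt hx)
  have hside : (∀ r, R < r → 1 < u r) ∨ (∀ r, R < r → u r < 1) := by
    by_contra! h
    obtain ⟨⟨x, hx, hx1⟩, ⟨y, hy, hy1⟩⟩ := h
    obtain ⟨t, ht, ht1⟩ := isPreconnected_Ioi.intermediate_value hx hy hcont ⟨hx1, hy1⟩
    exact hne t ht ht1
  rcases hside with h | h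
  · refine not_eventually_pos_of_linear_ineq (w := fun r => u r - 1) (w' := u') (w'' := u'')
      (m := (n : ℝ) - 1) (c := p - 1) (R := R) (by linarith)
      (fun r hr => (hu.hasDerivAt_u (hR0.trans_lt hr)).sub_const 1)
      (fun r hr => hu.hasDerivAt_u' (hR0.trans_lt hr))
      (fun r hr => sub_pos.mpr (h r hr)) fun r hr => ?_
    linarith [hu.ode r (hR0.trans_lt hr), mul_sub_one_le_f hp (hupos r hr)]
  · set e := u' R ^ 2 / 2 + F p (u R) with he
    have he0 : e < 0 := hu.energy_neg hn hp hb hE hub hbR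
    have hd : 0 < √(-(2 * e)) := sqrt_pos.mpr (by linarith)
    have hlow : ∀ r, R < r → √(-(2 * e)) ≤ u r := by
      intro r hr
      refine sqrt_le_iff.mpr ⟨(hupos r hr).le, ?_⟩
      have h1 : u' r ^ 2 / 2 + F p (u r) ≤ e :=
        hu.antitoneOn_energy (by omega) hp hR0 (hR0.trans hr.le) hr.le
      have h2 : 0 ≤ |u r| ^ (p + 1) / (p + 1) := by positivity
      rw [F] at h1
      linarith [sq_nonneg (u' r)]
    refine not_eventually_pos_of_linear_ineq (w := fun r => 1 - u r) (w' := fun r => -u' r)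
      (w'' := fun r => -u'' r)
      (m := (n : ℝ) - 1) (c := √(-(2 * e)) * min (p - 1) 1) (R := R)
      (mul_pos hd (lt_min (by linarith) one_pos))
      (fun r hr => (hu.hasDerivAt_u (hR0.trans_lt hr)).const_sub 1)
      (fun r hr => (hu.hasDerivAt_u' (hR0.trans_lt hr)).neg)
      (fun r hr => sub_pos.mpr (h r hr)) fun r hr => ?_
    linarith [hu.ode r (hR0.trans_lt hr),
      mul_one_sub_le_neg_f hp hd (hlow r hr) (h r hr).le]

lemma trapped_and_oscillates (hu : IsSolution n p α u u' u'') (hn : 2 ≤ n) (hp : 1 < p) {b : ℝ}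
    (hb : 0 ≤ b) (hE : u' b ^ 2 / 2 + F p (u b) ≤ 0) (hub : 0 < u b) :
    (∀ r : ℝ, b < r → 0 < u r ∧ u r < ((p + 1) / 2) ^ (1 / (p - 1))) ∧
      {r : ℝ | b < r ∧ u r = 1}.Infinite := by
  refine ⟨fun r hr => ?_, hu.infinite_eq_one hn hp hb hE hub⟩
  have hpos := hu.pos_of_energy_nonpos hn hp hb hE hub hr
  refine ⟨hpos, lt_of_F_neg hp hpos ?_⟩
  linarith [hu.energy_neg hn hp hb hE hub hr, sq_nonneg (u' r)]

end IsSolution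

/-- once the energy `E(r) = u'(r)²/2 + F(u(r))` is nonpositive, the solution is
trapped in `(0, α_*)` (resp. `(-α_*, 0)`) and oscillates about `1` (resp. `-1`). -/
theorem statement11 (n : ℕ) (hn : 3 ≤ n) (p : ℝ) (hp1 : 1 < p)
    (hp2 : p < ((n : ℝ) + 2) / ((n : ℝ) - 2))
    (α : ℝ) (hα : 0 < α) (hα1 : α ≠ 1)
    (u u' u'' : ℝ → ℝ) (hu : IsSolution n p α u u' u'')
    (rb : ℝ) (hrb : 0 ≤ rb) :
    (u' rb ^ 2 / 2 + F p (u rb) ≤ 0 → 0 < u rb →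
      (∀ r : ℝ, rb < r → 0 < u r ∧ u r < ((p + 1) / 2) ^ (1 / (p - 1))) ∧
      {r : ℝ | rb < r ∧ u r = 1}.Infinite) ∧
    (u' rb ^ 2 / 2 + F p (u rb) ≤ 0 → u rb < 0 →
      (∀ r : ℝ, rb < r → u r < 0 ∧ -(((p + 1) / 2) ^ (1 / (p - 1))) < u r) ∧
      {r : ℝ | rb < r ∧ u r = -1}.Infinite) := by
  refine ⟨hu.trapped_and_oscillates (by omega) hp1 hrb, fun hE hub => ?_⟩
  obtain ⟨h1, h2⟩ := hu.neg.trapped_and_oscillates (by omega) hp1 hrb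
    (by simpa [F_neg] using hE) (by simpa using hub)
  refine ⟨fun r hr => ?_, ?_⟩
  · have := h1 r hr
    simp only [Pi.neg_apply] at this
    constructor <;> linarith
  · simpa only [Pi.neg_apply, neg_eq_iff_eq_neg] using h2
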